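/- Let e : ℝ → ℝ and δ ≥ 0 satisfy |e(y) − y| ≤ δ for all y ∈ ℝ. Let v^{*,p} be the unique bounded fixed point of T^p and assume that v^{*,p} is 1-Lipschitz in its second argument (|v^{*,p}(s,z₁) − v^{*,p}(s,z₂)| ≤ |z₁ − z₂| for all s, z₁, z₂). Let v^{*,e} be the unique bounded fixed point of T^e. Then |v^{*,e}(s,z) − v^{*,p}(s,z)| ≤ γ·δ/(1−γ) for all (s,z) ∈ S × ℝ. -/

import Mathlib

/-- The clamp `p(x) = max (−c) (min x c)`. -/
noncomputable def clampP (c : ℝ) (x : ℝ) : ℝ := max (-c) (min x c)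

/-- The bounding operator `T^e`:
`T^e v (s, z) = max_{a ∈ A} [min 0 (r s a + z) - min 0 z
  + γ * Σ_{s'} P(s'|s,a) * v (s', p (e ((r s a + z) / γ)))]`,
where `p` is the clamp to `[-rγ, rγ]`. `T^p` is the case `e = id`. -/
noncomputable def Te {S A : Type*} [Fintype S] [Fintype A] [Nonempty A]
    (P : S → A → PMF S) (r : S → A → ℝ) (γ rγ : ℝ) (e : ℝ → ℝ)
    (v : S × ℝ → ℝ) : S × ℝ → ℝ :=
  fun x => Finset.univ.sup' Finset.univ_nonempty fun a =>
    min 0 (r x.1 a + x.2) - min 0 x.2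
      + γ * ∑ s' : S, ((P x.1 a) s').toReal *
          v (s', clampP rγ (e ((r x.1 a + x.2) / γ)))


theorem abs_clampP_sub_clampP_le (c x y : ℝ) : |clampP c x - clampP c y| ≤ |x - y| := by
  unfold clampP
  rw [max_comm (-c), max_comm (-c)]
  refine (abs_sup_sub_sup_le_abs _ _ _).trans ?_
  exact abs_inf_sub_inf_le_abs _ _ _

theorem Finset.abs_sup'_sub_sup'_le {ι : Type*} {t : Finset ι} (ht : t.Nonempty) {f g : ι → ℝ}
    {c : ℝ} (h : ∀ i ∈ t, |f i - g i| ≤ c) : |t.sup' ht f - t.sup' ht g| ≤ c := by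
  rw [abs_sub_le_iff, sub_le_iff_le_add, sub_le_iff_le_add]
  constructor <;> refine Finset.sup'_le ht _ fun i hi => ?_
  · linarith [(abs_sub_le_iff.1 (h i hi)).1, Finset.le_sup' g hi]
  · linarith [(abs_sub_le_iff.1 (h i hi)).2, Finset.le_sup' f hi]

theorem PMF.sum_toReal_eq_one {S : Type*} [Fintype S] (q : PMF S) :
    ∑ s, (q s).toReal = 1 := by
  rw [← ENNReal.toReal_sum fun s _ => q.apply_ne_top s, ← tsum_fintype (L := .unconditional S),
    q.tsum_coe, ENNReal.toReal_one]

theorem PMF.abs_sum_toReal_mul_sub_le {S : Type*} [Fintype S] (q : PMF S) {f g : S → ℝ} {c : ℝ}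
    (h : ∀ s, |f s - g s| ≤ c) :
    |∑ s, (q s).toReal * f s - ∑ s, (q s).toReal * g s| ≤ c := by
  rw [← Finset.sum_sub_distrib]
  calc |∑ s, ((q s).toReal * f s - (q s).toReal * g s)|
      ≤ ∑ s, |(q s).toReal * f s - (q s).toReal * g s| := Finset.abs_sum_le_sum_abs _ _
    _ ≤ ∑ s, (q s).toReal * c := Finset.sum_le_sum fun s _ => by
        rw [← mul_sub, abs_mul, abs_of_nonneg ENNReal.toReal_nonneg]
        exact mul_le_mul_of_nonneg_left (h s) ENNReal.toReal_nonneg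
    _ = c := by rw [← Finset.sum_mul, q.sum_toReal_eq_one, one_mul]

/-- Perturbing the value function by `K` and the rounding map by `δ` changes the operator by at most
`γ * (K + δ)`, provided the unperturbed value function is 1-Lipschitz in its second argument. -/
theorem abs_Te_sub_Te_le {S A : Type*} [Fintype S] [Fintype A] [Nonempty A]
    (P : S → A → PMF S) (r : S → A → ℝ) {γ : ℝ} (rγ : ℝ) (hγ : 0 ≤ γ) {e e' : ℝ → ℝ} {δ K : ℝ}
    (he : ∀ y, |e y - e' y| ≤ δ) {v w : S × ℝ → ℝ}
    (hlip : ∀ (s : S) (z₁ z₂ : ℝ), |w (s, z₁) - w (s, z₂)| ≤ |z₁ - z₂|)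
    (hK : ∀ x, |v x - w x| ≤ K) (x : S × ℝ) :
    |Te P r γ rγ e v x - Te P r γ rγ e' w x| ≤ γ * (K + δ) := by
  refine Finset.abs_sup'_sub_sup'_le _ fun a _ => ?_
  rw [add_sub_add_left_eq_sub, ← mul_sub, abs_mul, abs_of_nonneg hγ]
  refine mul_le_mul_of_nonneg_left ((P x.1 a).abs_sum_toReal_mul_sub_le fun s => ?_) hγ
  refine (abs_sub_le _ (w (s, clampP rγ (e ((r x.1 a + x.2) / γ)))) _).trans
    (add_le_add (hK _) ?_)
  exact (hlip _ _ _).trans ((abs_clampP_sub_clampP_le _ _ _).trans (he _))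

/-- if `|e(y) − y| ≤ δ` for all `y`, `v^{*,p}` is the unique bounded fixed point
of `T^p` which is moreover 1-Lipschitz in `z`, and `v^{*,e}` is the unique bounded fixed point
of `T^e`, then `|v^{*,e}(s,z) − v^{*,p}(s,z)| ≤ γ·δ/(1−γ)` for all `(s,z)`. -/
theorem Te_fixedPoint_error_bound
    {S A : Type*} [Fintype S] [Nonempty S] [Fintype A] [Nonempty A]
    (P : S → A → PMF S) (r : S → A → ℝ) (r_max : ℝ) (hr_max : 0 < r_max)
    (hr : ∀ s a, |r s a| ≤ r_max) (γ : ℝ) (hγ : γ ∈ Set.Ioo (0 : ℝ) 1)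
    (e : ℝ → ℝ) (δ : ℝ) (hδ : 0 ≤ δ) (he : ∀ y : ℝ, |e y - y| ≤ δ)
    (vp : S × ℝ → ℝ)
    (hbp : ∃ M : ℝ, ∀ s z, |vp (s, z)| ≤ M)
    (hfixp : Te P r γ (r_max / (1 - γ)) id vp = vp)
    (hlip : ∀ (s : S) (z₁ z₂ : ℝ), |vp (s, z₁) - vp (s, z₂)| ≤ |z₁ - z₂|)
    (ve : S × ℝ → ℝ)
    (hbe : ∃ M : ℝ, ∀ s z, |ve (s, z)| ≤ M)
    (hfixe : Te P r γ (r_max / (1 - γ)) e ve = ve) :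
    ∀ s z, |ve (s, z) - vp (s, z)| ≤ γ * δ / (1 - γ) := by
  obtain ⟨Mp, hMp⟩ := hbp
  obtain ⟨Me, hMe⟩ := hbe
  have hbdd : BddAbove (Set.range fun x : S × ℝ => |ve x - vp x|) := by
    refine ⟨Me + Mp, ?_⟩
    rintro _ ⟨⟨s, z⟩, rfl⟩
    exact (abs_sub _ _).trans (add_le_add (hMe s z) (hMp s z))
  have hK : ∀ x, |ve x - vp x| ≤ ⨆ x, |ve x - vp x| := fun x => le_ciSup hbdd x
  have hstep : (⨆ x, |ve x - vp x|) ≤ γ * ((⨆ x, |ve x - vp x|) + δ) := by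
    refine ciSup_le fun x => ?_
    have h := abs_Te_sub_Te_le P r (r_max / (1 - γ)) hγ.1.le (e' := id) he hlip hK x
    rwa [hfixe, hfixp] at h
  intro s z
  refine (hK (s, z)).trans ?_
  rw [le_div_iff₀ (sub_pos.2 hγ.2)]
  linarith
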